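/- Let E be a finite directed graph without sources, with a chosen associated edge at each vertex, and let k be a field. The projective Leavitt complex of E is acyclic: for every integer l, the kernel of δ^l equals the image of δ^{l−1}. -/

import Mathlib

open scoped Classical

/-- `IsPathOn s t v es` says that the list of edges `es` (in traversal order,
i.e. the first-applied edge first) forms a path starting at the vertex `v`
in the graph with source map `s` and target map `t`. -/
def IsPathOn {V E : Type} (s t : E → V) : V → List E → Prop
  | _, [] => True
  | v, a :: rest => s a = v ∧ IsPathOn s t (t a) rest

/-- A path is encoded as a pair: its starting vertex together with its list of
edges in traversal order.  A trivial path `e_i` is `(i, [])`. -/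
def IsPath {V E : Type} (s t : E → V) (p : V × List E) : Prop :=
  IsPathOn s t p.1 p.2

/-- The terminating vertex of a path. -/
def pterm {V E : Type} (t : E → V) (p : V × List E) : V :=
  p.2.getLast?.elim p.1 t

/-- `(p, q)` is an associated pair with respect to the choice of associated
edges `asc` (where `asc i` is the associated edge terminating at `i`). -/
def AssociatedPair {V E : Type} (s t : E → V) (asc : V → E) (p q : V × List E) : Prop :=
  IsPath s t p ∧ IsPath s t q ∧ p.1 = q.1 ∧
    (p.2 = [] ∨ q.2 = [] ∨
      ∃ a b, p.2.head? = some a ∧ q.2.head? = some b ∧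
        (a ≠ b ∨ (a = b ∧ a ∉ Set.range asc)))

/-- The index type for the basis of the projective Leavitt complex.  The index
`(none, p, q)` stands for the basis vector `e_i ζ_(p,q)` (with `i = t(p)`),
and `(some α, p, q)` stands for `α ζ_(p,q)` (with `s(α) = i = t(p)`). -/
abbrev IdxP (V E : Type) := Option E × ((V × List E) × (V × List E))

/-- The valid indices in degree `l`: `(p, q)` is an associated pair with
`l(q) - l(p) = l`, and the optional edge `α` satisfies `s(α) = t(p)`. -/
def ValidIdxP {V E : Type} (s t : E → V) (asc : V → E) (l : ℤ) (x : IdxP V E) : Prop :=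
  AssociatedPair s t asc x.2.1 x.2.2 ∧
    ((x.2.2.2.length : ℤ) - (x.2.1.2.length : ℤ) = l) ∧
    ∀ a ∈ x.1, s a = pterm t x.2.1

/-- The degree-`l` component `P^l` of the projective Leavitt complex, realized
as the span of the valid degree-`l` basis vectors inside the free `k`-module
on all indices. -/
noncomputable def PComp (k : Type) [Field k] {V E : Type} (s t : E → V)
    (asc : V → E) (l : ℤ) : Submodule k (IdxP V E →₀ k) :=
  Submodule.span k {f | ∃ x, ValidIdxP s t asc l x ∧ f = Finsupp.single x 1}

/-- The value of the differential of the projective Leavitt complex on a basis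
vector:  `δ(α ζ_(p,q)) = 0`;  if `p = β p̂` has length at least one, then
`δ(e_i ζ_(p,q)) = β ζ_(p̂, q)`;  if `p` has length zero, then
`δ(e_i ζ_(p,q)) = ∑_{β ∈ E¹, t(β) = i} β ζ_(e_{s(β)}, qβ)`. -/
noncomputable def DsingleP (k : Type) [Field k] {V E : Type} [Fintype E]
    (s t : E → V) (x : IdxP V E) : IdxP V E →₀ k :=
  match x with
  | (some _, _, _) => 0
  | (none, p, q) =>
    match p.2.getLast? with
    | some β => Finsupp.single (some β, (p.1, p.2.dropLast), q) 1
    | none =>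
      ∑ β ∈ Finset.univ.filter fun β => t β = p.1,
        Finsupp.single (some β, (s β, ([] : List E)), (s β, β :: q.2)) 1

/-- The differential of the projective Leavitt complex, as a `k`-linear
endomorphism of the free module on all indices (its restriction to `PComp l`
is the differential `δ^l : P^l → P^{l+1}`). -/
noncomputable def DP (k : Type) [Field k] {V E : Type} [Fintype E]
    (s t : E → V) : (IdxP V E →₀ k) →ₗ[k] (IdxP V E →₀ k) :=
  Finsupp.linearCombination k (DsingleP k s t)


theorem isPathOn_concat {V E : Type} (s t : E → V) (a : E) :
    ∀ (r : List E) (v : V),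
      IsPathOn s t v (r ++ [a]) ↔ IsPathOn s t v r ∧ s a = pterm t (v, r)
  | [], v => by simp [IsPathOn, pterm]
  | b :: r, v => by
    have ih := isPathOn_concat s t a r (t b)
    have hp : pterm t (v, b :: r) = pterm t (t b, r) := by
      rcases List.eq_nil_or_concat r with rfl | ⟨r', c, rfl⟩
      · simp [pterm]
      · simp [pterm, List.getLast?_cons]
    simp only [List.cons_append, IsPathOn, ih, hp, and_assoc]

/-- Contracting homotopy on basis vectors. -/
noncomputable def HsingleP (k : Type) [Field k] {V E : Type} [Fintype E]
    (s t : E → V) (asc : V → E) (x : IdxP V E) : IdxP V E →₀ k :=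
  match x with
  | (none, _, _) => 0
  | (some α, p, q) =>
    if p.2 = [] ∧ q.2.head? = some α ∧ asc (t α) = α then
      Finsupp.single (none, (t α, []), (t α, q.2.tail)) 1 -
        ∑ β ∈ (Finset.univ.filter fun β => t β = t α).erase α,
          Finsupp.single (none, (s β, [β]), (s β, β :: q.2.tail)) 1
    else Finsupp.single (none, (p.1, p.2 ++ [α]), q) 1

/-- The contracting homotopy. -/
noncomputable def HP (k : Type) [Field k] {V E : Type} [Fintype E]
    (s t : E → V) (asc : V → E) : (IdxP V E →₀ k) →ₗ[k] (IdxP V E →₀ k) :=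
  Finsupp.linearCombination k (HsingleP k s t asc)

section aux

variable (k : Type) [Field k] {V E : Type} [Fintype E] (s t : E → V) (asc : V → E)

theorem DP_some (α : E) (p q : V × List E) :
    DP k s t (Finsupp.single (some α, p, q) 1) = 0 := by
  simp [DP, DsingleP]

theorem DP_nil (v : V) (q : V × List E) :
    DP k s t (Finsupp.single (none, (v, []), q) 1) =
      ∑ β ∈ Finset.univ.filter fun β => t β = v,
        Finsupp.single (some β, (s β, ([] : List E)), (s β, β :: q.2)) 1 := by
  simp [DP, DsingleP]

theorem DP_concat (v : V) (r : List E) (a : E) (q : V × List E) :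
    DP k s t (Finsupp.single (none, (v, r ++ [a]), q) 1) =
      Finsupp.single (some a, (v, r), q) 1 := by
  simp [DP, DsingleP]

theorem DP_one (v : V) (a : E) (q : V × List E) :
    DP k s t (Finsupp.single (none, (v, [a]), q) 1) =
      Finsupp.single (some a, (v, []), q) 1 := by
  simp [DP, DsingleP]

theorem HP_none (p q : V × List E) :
    HP k s t asc (Finsupp.single (none, p, q) 1) = 0 := by
  simp [HP, HsingleP]

theorem HP_neg (α : E) (p q : V × List E)
    (h : ¬ (p.2 = [] ∧ q.2.head? = some α ∧ asc (t α) = α)) :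
    HP k s t asc (Finsupp.single (some α, p, q) 1) =
      Finsupp.single (none, (p.1, p.2 ++ [α]), q) 1 := by
  simp only [HP, Finsupp.linearCombination_single, one_smul, HsingleP, if_neg h]

theorem HP_pos (α : E) (u w : V) (r : List E) (h : asc (t α) = α) :
    HP k s t asc (Finsupp.single (some α, (u, []), (w, α :: r)) 1) =
      Finsupp.single (none, (t α, []), (t α, r)) 1 -
        ∑ β ∈ (Finset.univ.filter fun β => t β = t α).erase α,
          Finsupp.single (none, (s β, [β]), (s β, β :: r)) 1 := by
  simp [HP, HsingleP, h]

variable {k s t asc}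

theorem mem_PComp {l : ℤ} {x : IdxP V E} (h : ValidIdxP s t asc l x) :
    Finsupp.single x 1 ∈ PComp k s t asc l :=
  Submodule.subset_span ⟨x, h, rfl⟩

theorem homotopy_single (hasc : ∀ i, t (asc i) = i) {l : ℤ} (x : IdxP V E)
    (h : ValidIdxP s t asc l x) :
    DP k s t (HP k s t asc (Finsupp.single x 1)) +
      HP k s t asc (DP k s t (Finsupp.single x 1)) = Finsupp.single x 1 := by
  obtain ⟨o, ⟨v, r⟩, ⟨w, m⟩⟩ := x
  obtain ⟨⟨hp, hq, hv, ha⟩, hl, hs⟩ := h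
  simp only at hp hq hv ha hl hs
  subst hv
  rcases o with _ | α
  · rw [HP_none, map_zero, zero_add]
    rcases List.eq_nil_or_concat r with rfl | ⟨r', c, rfl⟩
    · rw [DP_nil, map_sum]
      have hm : asc v ∈ Finset.univ.filter fun β => t β = v := by simp [hasc]
      rw [← Finset.add_sum_erase _ _ hm, HP_pos _ _ _ _ _ _ _ _ (by rw [hasc])]
      simp only [hasc]
      rw [sub_add_eq_add_sub, sub_eq_iff_eq_add]
      congr 1
      refine Finset.sum_congr rfl fun β hβ => ?_
      simp only [Finset.mem_erase, Finset.mem_filter, Finset.mem_univ, true_and] at hβ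
      rw [HP_neg]
      · rfl
      · rintro ⟨_, _, h3⟩
        rw [hβ.2] at h3
        exact hβ.1 h3.symm
    · rw [List.concat_eq_append] at *
      rw [DP_concat, HP_neg]
      rintro ⟨h1, h2, h3⟩
      simp only at h1 h2
      subst h1
      rcases ha with ha | ha | ⟨a, b, ha, hb, hab⟩
      · simp at ha
      · simp [ha] at h2
      · simp at ha
        rw [h2] at hb
        simp at hb
        subst ha hb
        rcases hab with hab | hab
        · exact hab rfl
        · exact hab.2 ⟨_, h3⟩
  · rw [DP_some, map_zero, add_zero]
    have hs' : s α = pterm t (v, r) := hs α rfl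
    by_cases hc : r = [] ∧ m.head? = some α ∧ asc (t α) = α
    · obtain ⟨rfl, h2, h3⟩ := hc
      rcases m with _ | ⟨b, m⟩
      · simp at h2
      simp at h2
      subst h2
      have hsv : s b = v := by simpa [pterm] using hs'
      subst hsv
      rw [HP_pos _ _ _ _ _ _ _ _ h3, map_sub, map_sum, DP_nil]
      simp only [DP_one]
      have hm : b ∈ Finset.univ.filter fun β => t β = t b := by simp
      rw [← Finset.add_sum_erase _ _ hm]
      simp
    · rw [HP_neg _ _ _ _ _ _ _ hc, DP_concat]

theorem HP_mem (hasc : ∀ i, t (asc i) = i) {l : ℤ} (x : IdxP V E)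
    (h : ValidIdxP s t asc l x) :
    HP k s t asc (Finsupp.single x 1) ∈ PComp k s t asc (l - 1) := by
  obtain ⟨o, ⟨v, r⟩, ⟨w, m⟩⟩ := x
  obtain ⟨⟨hp, hq, hv, ha⟩, hl, hs⟩ := h
  simp only at hp hq hv ha hl hs
  subst hv
  rcases o with _ | α
  · rw [HP_none]; exact zero_mem _
  have hs' : s α = pterm t (v, r) := hs α rfl
  by_cases hc : r = [] ∧ m.head? = some α ∧ asc (t α) = α
  · obtain ⟨rfl, h2, h3⟩ := hc
    rcases m with _ | ⟨b, m⟩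
    · simp at h2
    simp at h2
    subst h2
    rw [HP_pos _ _ _ _ _ _ _ _ h3]
    have hq' : IsPathOn s t (t b) m := hq.2
    simp only [List.length_cons, List.length_nil] at hl
    push_cast at hl
    refine sub_mem (mem_PComp ⟨⟨trivial, hq', rfl, Or.inl rfl⟩, ?_, by simp⟩)
      (sum_mem fun β hβ => mem_PComp ⟨⟨⟨rfl, trivial⟩, ⟨rfl, ?_⟩, rfl, ?_⟩, ?_, by simp⟩)
    · simp only [List.length_nil]; push_cast; omega
    · simp only [Finset.mem_erase, Finset.mem_filter, Finset.mem_univ, true_and] at hβ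
      rw [hβ.2]; exact hq'
    · simp only [Finset.mem_erase, Finset.mem_filter, Finset.mem_univ, true_and] at hβ
      refine Or.inr (Or.inr ⟨β, β, rfl, rfl, Or.inr ⟨rfl, ?_⟩⟩)
      rintro ⟨i, hi⟩
      have hti : t β = i := by rw [← hi, hasc]
      rw [← hti, hβ.2, h3] at hi
      exact hβ.1 hi.symm
    · simp only [List.length_nil, List.length_cons]; push_cast; omega
  · rw [HP_neg _ _ _ _ _ _ _ hc]
    refine mem_PComp ⟨⟨(isPathOn_concat s t α r v).2 ⟨hp, hs'⟩, hq, rfl, ?_⟩, ?_, by simp⟩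
    · rcases r with _ | ⟨c, r⟩
      · rcases m with _ | ⟨b, m⟩
        · exact Or.inr (Or.inl rfl)
        · refine Or.inr (Or.inr ⟨α, b, rfl, rfl, ?_⟩)
          by_cases hab : α = b
          · refine Or.inr ⟨hab, ?_⟩
            rintro ⟨i, hi⟩
            refine hc ⟨rfl, by simp [hab], ?_⟩
            rw [← hi, hasc]
          · exact Or.inl hab
      · rcases ha with ha | ha | ⟨a, b, ha, hb, hab⟩
        · simp at ha
        · exact Or.inr (Or.inl ha)
        · exact Or.inr (Or.inr ⟨a, b, by simpa using ha, hb, hab⟩)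
    · simp only [List.length_append, List.length_cons, List.length_nil]; push_cast; omega

theorem DP_mem {l : ℤ} (x : IdxP V E) (h : ValidIdxP s t asc (l - 1) x) :
    DP k s t (Finsupp.single x 1) ∈ PComp k s t asc l := by
  obtain ⟨o, ⟨v, r⟩, ⟨w, m⟩⟩ := x
  obtain ⟨⟨hp, hq, hv, ha⟩, hl, hs⟩ := h
  simp only at hp hq hv ha hl hs
  subst hv
  rcases o with _ | α
  · rcases List.eq_nil_or_concat r with rfl | ⟨r', c, rfl⟩
    · rw [DP_nil]
      refine sum_mem fun β hβ => mem_PComp ⟨⟨trivial, ⟨rfl, ?_⟩, rfl, Or.inl rfl⟩, ?_, ?_⟩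
      · simp only [Finset.mem_filter, Finset.mem_univ, true_and] at hβ
        rw [hβ]; exact hq
      · simp only [List.length_nil, List.length_cons] at *; push_cast at *; omega
      · simp [pterm]
    · rw [List.concat_eq_append] at *
      rw [DP_concat]
      obtain ⟨hp1, hp2⟩ := (isPathOn_concat s t c r' v).1 hp
      refine mem_PComp ⟨⟨hp1, hq, rfl, ?_⟩, ?_, ?_⟩
      · rcases r' with _ | ⟨d, r'⟩
        · exact Or.inl rfl
        · rcases ha with ha | ha | ⟨a, b, ha, hb, hab⟩
          · simp at ha
          · exact Or.inr (Or.inl ha)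
          · exact Or.inr (Or.inr ⟨a, b, by simpa using ha, hb, hab⟩)
      · simp only [List.length_append, List.length_cons, List.length_nil] at *
        push_cast at *; omega
      · intro a ha'
        simp only [Option.mem_some_iff] at ha'
        subst ha'; exact hp2
  · rw [DP_some]; exact zero_mem _

theorem DP_DP (x : IdxP V E) : DP k s t (DP k s t (Finsupp.single x 1)) = 0 := by
  obtain ⟨o, ⟨v, r⟩, q⟩ := x
  rcases o with _ | α
  · rcases List.eq_nil_or_concat r with rfl | ⟨r', c, rfl⟩
    · rw [DP_nil, map_sum]
      exact Finset.sum_eq_zero fun β _ => DP_some _ _ _ _ _ _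
    · rw [List.concat_eq_append, DP_concat, DP_some]
  · rw [DP_some, map_zero]

end aux

/-- The projective Leavitt complex of a finite graph without sources (with a
chosen associated edge `asc i` terminating at each vertex `i`) is acyclic:
for every integer `l`, the kernel of `δ^l : P^l → P^{l+1}` equals the image of
`δ^{l-1} : P^{l-1} → P^l`. -/
theorem projectiveLeavitt_acyclic (k : Type) [Field k] {V E : Type}
    [Fintype V] [Fintype E] (s t : E → V) (asc : V → E)
    (hasc : ∀ i, t (asc i) = i) (l : ℤ) :
    {x : IdxP V E →₀ k | x ∈ PComp k s t asc l ∧ DP k s t x = 0} =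
      (DP k s t) '' (PComp k s t asc (l - 1) : Set (IdxP V E →₀ k)) := by
  ext x
  constructor
  · rintro ⟨hx, h0⟩
    have hh : DP k s t (HP k s t asc x) + HP k s t asc (DP k s t x) = x := by
      clear h0
      induction hx using Submodule.span_induction with
      | mem y hy =>
        obtain ⟨z, hz, rfl⟩ := hy
        exact homotopy_single hasc z hz
      | zero => simp
      | add y z _ _ hy hz =>
        simp only [map_add]
        rw [add_add_add_comm, hy, hz]
      | smul c y _ hy =>
        simp only [map_smul]
        rw [← smul_add, hy]
    rw [h0, map_zero, add_zero] at hh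
    refine ⟨HP k s t asc x, ?_, hh⟩
    have hle : PComp k s t asc l ≤ (PComp k s t asc (l - 1)).comap (HP k s t asc) := by
      refine Submodule.span_le.2 ?_
      rintro _ ⟨z, hz, rfl⟩
      exact HP_mem hasc z hz
    exact hle hx
  · rintro ⟨y, hy, rfl⟩
    constructor
    · have hle : PComp k s t asc (l - 1) ≤ (PComp k s t asc l).comap (DP k s t) := by
        refine Submodule.span_le.2 ?_
        rintro _ ⟨z, hz, rfl⟩
        exact DP_mem z hz
      exact hle hy
    · have hle : PComp k s t asc (l - 1) ≤ LinearMap.ker (DP k s t ∘ₗ DP k s t) := by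
        refine Submodule.span_le.2 ?_
        rintro _ ⟨z, hz, rfl⟩
        exact DP_DP z
      exact hle hy
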